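/- arXiv:1306.3778 — 3 statements merged into one kernel-verified Lean document; each statement's English description precedes it below -/
import Mathlib

section
/- Let A be a real m×n matrix and let 1 ≤ k ≤ n. Suppose that every nonzero vector w ∈ ℝⁿ in the null space of A (i.e., Aw = 0) satisfies Σ_{i=n-k+1}^{n} |w_i| < Σ_{i=1}^{n-k} |w_i|. Then for every vector x ∈ ℝⁿ with x_i = 0 for all 1 ≤ i ≤ n-k, x is the unique minimizer of ‖z‖₁ over the set {z ∈ ℝⁿ : Az = Ax}; that is, every z with Az = Ax and ‖z‖₁ ≤ ‖x‖₁ equals x. -/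
/-- **Sectional null-space sufficiency (strict version).**
If every nonzero vector `w` in the null space of `A` satisfies
`∑_{i=n-k+1}^{n} |w_i| < ∑_{i=1}^{n-k} |w_i|`, then every vector `x` supported on the
last `k` coordinates is the unique ℓ₁ minimizer over `{z : Az = Ax}`. -/
theorem sectional_nullspace_sufficiency_strict
    (m n k : ℕ) (hk1 : 1 ≤ k) (hkn : k ≤ n)
    (A : Matrix (Fin m) (Fin n) ℝ)
    (hns : ∀ w : Fin n → ℝ, A.mulVec w = 0 → w ≠ 0 →
      (∑ i ∈ Finset.univ.filter (fun i : Fin n => n - k ≤ (i : ℕ)), |w i|) <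
      (∑ i ∈ Finset.univ.filter (fun i : Fin n => (i : ℕ) < n - k), |w i|)) :
    ∀ x : Fin n → ℝ, (∀ i : Fin n, (i : ℕ) < n - k → x i = 0) →
      ∀ z : Fin n → ℝ, A.mulVec z = A.mulVec x →
        (∑ i, |z i|) ≤ (∑ i, |x i|) → z = x := by
  intro x hx z hz hle
  by_contra hne
  have hlt := hns (z - x) (by rw [Matrix.mulVec_sub, hz, sub_self]) (sub_ne_zero.mpr hne)
  have hsplit (f : Fin n → ℝ) :
      (∑ i ∈ Finset.univ.filter (fun i : Fin n => (i : ℕ) < n - k), f i) +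
        ∑ i ∈ Finset.univ.filter (fun i : Fin n => n - k ≤ (i : ℕ)), f i = ∑ i, f i := by
    simpa only [not_lt] using
      Finset.sum_filter_add_sum_filter_not Finset.univ (fun i : Fin n => (i : ℕ) < n - k) f
  have hhead : ∑ i ∈ Finset.univ.filter (fun i : Fin n => (i : ℕ) < n - k), |(z - x) i| ≤
      ∑ i ∈ Finset.univ.filter (fun i : Fin n => (i : ℕ) < n - k), (|z i| - |x i|) := by
    refine Finset.sum_le_sum fun i hi => ?_
    simp [hx i (Finset.mem_filter.mp hi).2]
  have htail : ∑ i ∈ Finset.univ.filter (fun i : Fin n => n - k ≤ (i : ℕ)), -|(z - x) i| ≤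
      ∑ i ∈ Finset.univ.filter (fun i : Fin n => n - k ≤ (i : ℕ)), (|z i| - |x i|) := by
    refine Finset.sum_le_sum fun i _ => ?_
    rw [Pi.sub_apply, abs_sub_comm]
    linarith [abs_sub_abs_le_abs_sub (x i) (z i)]
  have htotal := (hsplit fun i => |z i| - |x i|).trans
    (Finset.sum_sub_distrib (fun i => |z i|) fun i => |x i|)
  rw [Finset.sum_neg_distrib] at htail
  linarith
end

section
/- Let A be a real m×n matrix and let 1 ≤ k ≤ n. Suppose there exists a vector w ∈ ℝⁿ with Aw = 0 and Σ_{i=n-k+1}^{n} |w_i| > Σ_{i=1}^{n-k} |w_i|. Then there exists a vector x ∈ ℝⁿ with x_i = 0 for all 1 ≤ i ≤ n-k and a vector z ∈ ℝⁿ with Az = Ax and ‖z‖₁ < ‖x‖₁; in particular, x is not a minimizer of the ℓ₁ norm over {z : Az = Ax}. -/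
/-- **Sectional null-space failure (converse part).**
If some vector `w` in the null space of `A` satisfies
`∑_{i=n-k+1}^{n} |w_i| > ∑_{i=1}^{n-k} |w_i|`, then there is a vector `x` supported on the
last `k` coordinates which is not an ℓ₁ minimizer over `{z : Az = Ax}`: some `z` with
`Az = Ax` has strictly smaller ℓ₁ norm. -/
theorem sectional_nullspace_failure
    (m n k : ℕ) (hk1 : 1 ≤ k) (hkn : k ≤ n)
    (A : Matrix (Fin m) (Fin n) ℝ)
    (hw : ∃ w : Fin n → ℝ, A.mulVec w = 0 ∧
      (∑ i ∈ Finset.univ.filter (fun i : Fin n => (i : ℕ) < n - k), |w i|) <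
      (∑ i ∈ Finset.univ.filter (fun i : Fin n => n - k ≤ (i : ℕ)), |w i|)) :
    ∃ x z : Fin n → ℝ, (∀ i : Fin n, (i : ℕ) < n - k → x i = 0) ∧
      A.mulVec z = A.mulVec x ∧ (∑ i, |z i|) < (∑ i, |x i|) := by
  obtain ⟨w, hAw, hlt⟩ := hw
  let x : Fin n → ℝ := fun i => if n - k ≤ (i : ℕ) then w i else 0
  have hz : ∀ i, |(x - w) i| = if (i : ℕ) < n - k then |w i| else 0 := by
    intro i
    rcases lt_or_ge (i : ℕ) (n - k) with h | h
    · rw [Pi.sub_apply, if_pos h, show x i = 0 from if_neg h.not_ge, zero_sub, abs_neg]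
    · rw [Pi.sub_apply, if_neg h.not_gt, show x i = w i from if_pos h, sub_self, abs_zero]
  have hx : ∀ i, |x i| = if n - k ≤ (i : ℕ) then |w i| else 0 := fun i => by
    rw [apply_ite abs, abs_zero]
  refine ⟨x, x - w, fun i hi => if_neg (not_le.mpr hi), ?_, ?_⟩
  · rw [Matrix.mulVec_sub, hAw, sub_zero]
  · simpa only [hz, hx, ← Finset.sum_filter] using hlt
end

section
/- Let A be a real m×n matrix and 1 ≤ k ≤ n. Suppose every w ∈ ℝⁿ with Aw = 0 satisfies Σ_{i=n-k+1}^{n} |w_i| ≤ Σ_{i=1}^{n-k} |w_i|. Then for every x ∈ ℝⁿ with x_i = 0 for all 1 ≤ i ≤ n-k and for every z ∈ ℝⁿ with Az = Ax, one has ‖x‖₁ ≤ ‖z‖₁; that is, x is a (not necessarily unique) minimizer of the ℓ₁ norm over {z : Az = Ax}. -/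
/-- **Sectional null-space sufficiency (non-strict version).**
If every vector `w` in the null space of `A` satisfies
`∑_{i=n-k+1}^{n} |w_i| ≤ ∑_{i=1}^{n-k} |w_i|`, then every vector `x` supported on the last
`k` coordinates is an ℓ₁ minimizer over `{z : Az = Ax}`. -/
theorem sectional_nullspace_sufficiency_nonstrict
    (m n k : ℕ) (hk1 : 1 ≤ k) (hkn : k ≤ n)
    (A : Matrix (Fin m) (Fin n) ℝ)
    (hns : ∀ w : Fin n → ℝ, A.mulVec w = 0 →
      (∑ i ∈ Finset.univ.filter (fun i : Fin n => n - k ≤ (i : ℕ)), |w i|) ≤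
      (∑ i ∈ Finset.univ.filter (fun i : Fin n => (i : ℕ) < n - k), |w i|)) :
    ∀ x : Fin n → ℝ, (∀ i : Fin n, (i : ℕ) < n - k → x i = 0) →
      ∀ z : Fin n → ℝ, A.mulVec z = A.mulVec x →
        (∑ i, |x i|) ≤ (∑ i, |z i|) := by
  intro x hx z hz
  have hw := hns (z - x) (by rw [Matrix.mulVec_sub, hz, sub_self])
  have hsplit (f : Fin n → ℝ) :
      (∑ i ∈ Finset.univ.filter (fun i : Fin n => (i : ℕ) < n - k), f i) +
        (∑ i ∈ Finset.univ.filter (fun i : Fin n => n - k ≤ (i : ℕ)), f i) = ∑ i, f i := by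
    simpa only [not_lt] using
      Finset.sum_filter_add_sum_filter_not Finset.univ (fun i : Fin n => (i : ℕ) < n - k) f
  have hxhead : ∑ i ∈ Finset.univ.filter (fun i : Fin n => (i : ℕ) < n - k), |x i| = 0 :=
    Finset.sum_eq_zero fun i hi => by rw [hx i (Finset.mem_filter.mp hi).2, abs_zero]
  have hzhead : ∑ i ∈ Finset.univ.filter (fun i : Fin n => (i : ℕ) < n - k), |(z - x) i| =
      ∑ i ∈ Finset.univ.filter (fun i : Fin n => (i : ℕ) < n - k), |z i| :=
    Finset.sum_congr rfl fun i hi => by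
      rw [Pi.sub_apply, hx i (Finset.mem_filter.mp hi).2, sub_zero]
  have htail : ∑ i ∈ Finset.univ.filter (fun i : Fin n => n - k ≤ (i : ℕ)), |x i| ≤
      (∑ i ∈ Finset.univ.filter (fun i : Fin n => n - k ≤ (i : ℕ)), |z i|) +
        ∑ i ∈ Finset.univ.filter (fun i : Fin n => n - k ≤ (i : ℕ)), |(z - x) i| := by
    rw [← Finset.sum_add_distrib]
    refine Finset.sum_le_sum fun i _ => ?_
    simpa using abs_sub (z i) (z i - x i)
  linarith [hsplit fun i => |x i|, hsplit fun i => |z i|]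
end
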